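/- arXiv:2208.09760 — 2 statements merged into one kernel-verified Lean document; each statement's English description precedes it below -/
import Mathlib

section
/- For every positive integer f, the number of numerical semigroups with Frobenius number f whose positive sporadic elements form a two-element set {x_1, x_2} with x_1 < x_2 and x_1 + x_1 > f equals the binomial coefficient C((f−2)/2, 2) if f is even and C((f−1)/2, 2) if f is odd. -/
/-- A numerical semigroup: a subset of ℕ containing 0, closed under addition,
with finite complement. -/
def IsNumericalSemigroup (S : Set ℕ) : Prop :=
  0 ∈ S ∧ (∀ a ∈ S, ∀ b ∈ S, a + b ∈ S) ∧ Sᶜ.Finite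

/-- `f` is the Frobenius number of `S`: the largest gap. -/
def IsFrobenius (S : Set ℕ) (f : ℕ) : Prop :=
  f ∉ S ∧ ∀ m, m ∉ S → m ≤ f

/-- The set consisting of `0`, the elements of `T`, and all integers greater than `f`. -/
def semigroupOfSporadic (f : ℕ) (T : Finset ℕ) : Set ℕ :=
  {n | n = 0 ∨ n ∈ T ∨ f < n}

theorem isNumericalSemigroup_semigroupOfSporadic {f : ℕ} {T : Finset ℕ}
    (hT : ∀ x ∈ T, f < x + x) : IsNumericalSemigroup (semigroupOfSporadic f T) := by
  refine ⟨Or.inl rfl, ?_, (Set.finite_Iic f).subset fun n hn => ?_⟩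
  · rintro a (rfl | ha | ha) b (rfl | hb | hb)
    · exact Or.inl rfl
    · rw [zero_add]
      exact Or.inr (Or.inl hb)
    · exact Or.inr (Or.inr (by omega))
    · rw [add_zero]
      exact Or.inr (Or.inl ha)
    · have := hT a ha
      have := hT b hb
      exact Or.inr (Or.inr (by omega))
    all_goals exact Or.inr (Or.inr (by omega))
  · by_contra h
    exact hn (Or.inr (Or.inr (by simpa using h)))

theorem isFrobenius_semigroupOfSporadic {f : ℕ} (hf : 0 < f) {T : Finset ℕ}
    (hT : ∀ x ∈ T, x < f) : IsFrobenius (semigroupOfSporadic f T) f := by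
  refine ⟨?_, fun m hm => ?_⟩
  · rintro (h | h | h)
    · omega
    · exact (hT f h).false
    · omega
  · by_contra h
    exact hm (Or.inr (Or.inr (by omega)))

theorem sporadic_semigroupOfSporadic {f : ℕ} {T : Finset ℕ} (hT : ∀ x ∈ T, 0 < x ∧ x < f) :
    {s ∈ semigroupOfSporadic f T | 0 < s ∧ s < f} = T := by
  ext s
  constructor
  · rintro ⟨h | h | h, h0, hs⟩
    · omega
    · exact h
    · omega
  · exact fun h => ⟨Or.inr (Or.inl h), hT s h⟩

theorem eq_semigroupOfSporadic {S : Set ℕ} {f : ℕ} {T : Finset ℕ} (h0 : 0 ∈ S)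
    (hf : IsFrobenius S f) (hT : {s ∈ S | 0 < s ∧ s < f} = T) :
    S = semigroupOfSporadic f T := by
  ext n
  have hn : (n ∈ S ∧ 0 < n ∧ n < f) ↔ n ∈ T := Set.ext_iff.mp hT n
  constructor
  · intro h
    rcases Nat.eq_zero_or_pos n with h' | h'
    · exact Or.inl h'
    rcases lt_trichotomy n f with h'' | rfl | h''
    · exact Or.inr (Or.inl (hn.mp ⟨h, h', h''⟩))
    · exact absurd h hf.1
    · exact Or.inr (Or.inr h'')
  · rintro (rfl | h | h)
    · exact h0
    · exact (hn.mpr h).1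
    · by_contra h'
      exact absurd (hf.2 n h') (by omega)

theorem setOf_two_sporadic_eq_image (f : ℕ) (hf : 0 < f) :
    {S : Set ℕ | IsNumericalSemigroup S ∧ IsFrobenius S f ∧
        ∃ x₁ x₂ : ℕ, x₁ < x₂ ∧ f < x₁ + x₁ ∧ {s ∈ S | 0 < s ∧ s < f} = {x₁, x₂}}
      = semigroupOfSporadic f '' ((Finset.Ioo (f / 2) f).powersetCard 2 : Set (Finset ℕ)) := by
  ext S
  simp only [Set.mem_ofPred_eq, Set.mem_image, Finset.mem_coe, Finset.mem_powersetCard]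
  constructor
  · rintro ⟨hS, hF, x₁, x₂, hlt, hx, hs⟩
    refine ⟨{x₁, x₂}, ⟨fun x hx' => ?_, Finset.card_pair hlt.ne⟩,
      (eq_semigroupOfSporadic hS.1 hF (by simpa using hs)).symm⟩
    have hxs : x ∈ {s ∈ S | 0 < s ∧ s < f} := by
      rw [hs]
      simpa using hx'
    have hx_lt := hxs.2.2
    rw [Finset.mem_insert, Finset.mem_singleton] at hx'
    rw [Finset.mem_Ioo]
    omega
  · rintro ⟨T, ⟨hT, hc⟩, rfl⟩
    have hb : ∀ x ∈ T, f < x + x ∧ 0 < x ∧ x < f := fun x hx => by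
      have := Finset.mem_Ioo.mp (hT hx)
      omega
    refine ⟨isNumericalSemigroup_semigroupOfSporadic fun x hx => (hb x hx).1,
      isFrobenius_semigroupOfSporadic hf fun x hx => (hb x hx).2.2, ?_⟩
    rw [sporadic_semigroupOfSporadic fun x hx => (hb x hx).2]
    obtain ⟨x, y, hxy, rfl⟩ := Finset.card_eq_two.mp hc
    rcases hxy.lt_or_gt with h | h
    · exact ⟨x, y, h, (hb x (by simp)).1, by simp⟩
    · exact ⟨y, x, h, (hb y (by simp)).1, by simp [Set.pair_comm]⟩

theorem injOn_semigroupOfSporadic (f : ℕ) :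
    Set.InjOn (semigroupOfSporadic f) {T | ∀ x ∈ T, 0 < x ∧ x < f} := by
  intro T hT U hU h
  rw [← Finset.coe_inj, ← sporadic_semigroupOfSporadic hT, h, sporadic_semigroupOfSporadic hU]

/-- The number of numerical semigroups with Frobenius number `f` whose positive sporadic
elements are `{x₁, x₂}` with `x₁ < x₂` and `x₁ + x₁ > f` is `C((f-2)/2, 2)` for even `f`
and `C((f-1)/2, 2)` for odd `f`. -/
theorem count_two_sporadic_no_relation (f : ℕ) (hf : 0 < f) :
    {S : Set ℕ | IsNumericalSemigroup S ∧ IsFrobenius S f ∧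
        ∃ x₁ x₂ : ℕ, x₁ < x₂ ∧ f < x₁ + x₁ ∧
          {s ∈ S | 0 < s ∧ s < f} = {x₁, x₂}}.ncard
      = if f % 2 = 0 then ((f - 2) / 2).choose 2 else ((f - 1) / 2).choose 2 := by
  have hinj : Set.InjOn (semigroupOfSporadic f)
      ((Finset.Ioo (f / 2) f).powersetCard 2 : Set (Finset ℕ)) := by
    refine (injOn_semigroupOfSporadic f).mono ?_
    intro T hT x hx
    have := Finset.mem_Ioo.mp ((Finset.mem_powersetCard.mp (Finset.mem_coe.mp hT)).1 hx)
    omega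
  rw [setOf_two_sporadic_eq_image f hf, hinj.ncard_image, Set.ncard_coe_finset,
    Finset.card_powersetCard, Nat.card_Ioo]
  split_ifs <;> congr 1 <;> omega
end

section
/- Let C ⊆ ℝ^d be a pointed rational polyhedral cone, let P ⊆ ℝ^d be a C-compatible polytope, let n and α be positive integers, and let τ be a truncated addition table over n elements. Then the map (x_1, …, x_n) ↦ {0} ∪ {x_1, …, x_n} ∪ ((C \ αP) ∩ ℤ^d) is a bijection between the integer lattice points of α·P_τ^{(C,P)} and the set of C-semigroups S with exactly n nonzero elements in αP, all gaps contained in αP, and whose nonzero elements x_1 <_lex ⋯ <_lex x_n in αP satisfy x_i + x_j = x_k whenever τ(i,j) = k < ∞ and x_i + x_j ∈ C \ αP whenever τ(i,j) = ∞. -/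
open Pointwise

/-- The real vector in ℝ^d corresponding to an integer lattice point. -/
def intVec {d : ℕ} (x : Fin d → ℤ) : Fin d → ℝ := fun i => (x i : ℝ)

/-- A rational polyhedral cone: the set of nonnegative real linear combinations of
finitely many integer vectors. -/
def IsRationalPolyhedralCone {d : ℕ} (C : Set (Fin d → ℝ)) : Prop :=
  ∃ (k : ℕ) (v : Fin k → Fin d → ℝ), (∀ i j, ∃ z : ℤ, v i j = (z : ℝ)) ∧
    C = {x | ∃ c : Fin k → ℝ, (∀ i, 0 ≤ c i) ∧ x = ∑ i, c i • v i}

/-- A cone is pointed if `C ∩ (−C) = {0}`. -/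
def IsPointed {d : ℕ} (C : Set (Fin d → ℝ)) : Prop := C ∩ (-C) = {0}

/-- A rational polytope: the convex hull of finitely many rational points. -/
def IsRationalPolytope {d : ℕ} (P : Set (Fin d → ℝ)) : Prop :=
  ∃ (k : ℕ) (v : Fin k → Fin d → ℝ), (∀ i j, ∃ q : ℚ, v i j = (q : ℝ)) ∧
    P = convexHull ℝ (Set.range v)

/-- `P` contains a neighborhood of the origin in `C`. -/
def ContainsConeNbhdOfZero {d : ℕ} (C P : Set (Fin d → ℝ)) : Prop :=
  ∃ ε : ℝ, 0 < ε ∧ ∀ x ∈ C, (∀ i, |x i| < ε) → x ∈ P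

/-- `P` is a `C`-compatible polytope: a rational polytope containing a neighborhood of
the origin in `C` such that for every `x ∈ C \ P`, `x + C ⊆ C \ P`. -/
def IsCCompatible {d : ℕ} (C P : Set (Fin d → ℝ)) : Prop :=
  IsRationalPolytope P ∧ ContainsConeNbhdOfZero C P ∧
    ∀ x ∈ C \ P, ∀ y ∈ C, x + y ∈ C \ P

/-- Lexicographic order on ℝ^d. -/
def lexLt {d : ℕ} (x y : Fin d → ℝ) : Prop :=
  ∃ i : Fin d, (∀ j, j < i → x j = y j) ∧ x i < y i

/-- A `C`-semigroup (presented as a set of lattice points): contains 0, closed under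
addition, contained in `C`, with finite complement in `C ∩ ℤ^d`. -/
def IsCSemigroup {d : ℕ} (C : Set (Fin d → ℝ)) (S : Set (Fin d → ℤ)) : Prop :=
  0 ∈ S ∧ (∀ x ∈ S, ∀ y ∈ S, x + y ∈ S) ∧ (∀ x ∈ S, intVec x ∈ C) ∧
    {x : Fin d → ℤ | intVec x ∈ C ∧ x ∉ S}.Finite

/-- The set `P_τ^{(C,P)} ⊆ (ℝ^d)^n` associated to a truncated addition table `τ`
(`τ i j = none` encodes the value ∞). -/
def AffineSRSet (d n : ℕ) (C P : Set (Fin d → ℝ))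
    (τ : Fin n → Fin n → Option (Fin n)) : Set (Fin n → Fin d → ℝ) :=
  {x | (∀ i j : Fin n, i < j → lexLt (x i) (x j)) ∧
    (∀ i, x i ∈ C ∧ x i ≠ 0) ∧ (∀ i, x i ∈ P) ∧
    (∀ i j k, τ i j = some k → x i + x j = x k) ∧
    (∀ i j, τ i j = none → x i + x j ∉ P)}

theorem intVec_add {d : ℕ} (x y : Fin d → ℤ) : intVec (x + y) = intVec x + intVec y := by
  ext i; simp [intVec]

theorem intVec_injective {d : ℕ} : Function.Injective (intVec (d := d)) := by
  intro x y h
  ext i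
  exact Int.cast_injective (congrFun h i)

theorem intVec_eq_zero {d : ℕ} {x : Fin d → ℤ} : intVec x = 0 ↔ x = 0 := by
  rw [← intVec_injective.eq_iff]
  simp [intVec, funext_iff]

theorem lexLt_intVec {d : ℕ} {x y : Fin d → ℤ} :
    lexLt (intVec x) (intVec y) ↔ toLex x < toLex y := by
  simp only [lexLt, intVec, Int.cast_inj, Int.cast_lt]
  rfl

theorem lexLt_smul {d : ℕ} {c : ℝ} (hc : 0 < c) {x y : Fin d → ℝ} (h : lexLt x y) :
    lexLt (c • x) (c • y) := by
  obtain ⟨i, hi, hlt⟩ := h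
  exact ⟨i, fun j hj => by simp [hi j hj], by simpa using mul_lt_mul_of_pos_left hlt hc⟩

namespace IsRationalPolyhedralCone

variable {d : ℕ} {C : Set (Fin d → ℝ)}

theorem zero_mem (hC : IsRationalPolyhedralCone C) : 0 ∈ C := by
  obtain ⟨k, v, -, rfl⟩ := hC
  exact ⟨0, by simp, by simp⟩

theorem add_mem (hC : IsRationalPolyhedralCone C) {x y : Fin d → ℝ} (hx : x ∈ C) (hy : y ∈ C) :
    x + y ∈ C := by
  obtain ⟨k, v, -, rfl⟩ := hC
  obtain ⟨a, ha, rfl⟩ := hx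
  obtain ⟨b, hb, rfl⟩ := hy
  exact ⟨a + b, fun i => add_nonneg (ha i) (hb i), by simp [add_smul, Finset.sum_add_distrib]⟩

theorem smul_mem (hC : IsRationalPolyhedralCone C) {c : ℝ} (hc : 0 ≤ c) {x : Fin d → ℝ}
    (hx : x ∈ C) : c • x ∈ C := by
  obtain ⟨k, v, -, rfl⟩ := hC
  obtain ⟨a, ha, rfl⟩ := hx
  exact ⟨c • a, fun i => mul_nonneg hc (ha i), by simp [Finset.smul_sum, mul_smul]⟩

end IsRationalPolyhedralCone

theorem IsRationalPolytope.isBounded {d : ℕ} {P : Set (Fin d → ℝ)} (hP : IsRationalPolytope P) :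
    Bornology.IsBounded P := by
  obtain ⟨k, v, -, rfl⟩ := hP
  exact isBounded_convexHull.2 (Set.finite_range v).isBounded

/-- A bounded set contains only finitely many lattice points. -/
theorem finite_intVec_mem {d : ℕ} {B : Set (Fin d → ℝ)} (hB : Bornology.IsBounded B) :
    {x : Fin d → ℤ | intVec x ∈ B}.Finite := by
  obtain ⟨r, hr⟩ := hB.subset_closedBall 0
  refine (Set.finite_Icc (fun _ : Fin d => -⌈r⌉) (fun _ => ⌈r⌉)).subset fun x hx => ?_
  have h : ∀ i, |(x i : ℝ)| ≤ ⌈r⌉ := fun i => by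
    have h1 := mem_closedBall_zero_iff.1 (hr hx)
    exact ((norm_le_pi_norm (intVec x) i).trans h1).trans (Int.le_ceil r)
  exact ⟨fun i => by exact_mod_cast (abs_le.1 (h i)).1,
    fun i => by exact_mod_cast (abs_le.1 (h i)).2⟩

theorem add_mem_diff_smul {d : ℕ} {C P : Set (Fin d → ℝ)} (hC : IsRationalPolyhedralCone C)
    (hP : IsCCompatible C P) {c : ℝ} (hc : 0 < c) {x y : Fin d → ℝ} (hx : x ∈ C \ c • P)
    (hy : y ∈ C) : x + y ∈ C \ c • P := by
  refine ⟨hC.add_mem hx.1 hy, fun h => ?_⟩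
  have hi : 0 ≤ c⁻¹ := (inv_pos.2 hc).le
  have hxP := hx.2
  rw [Set.mem_smul_set_iff_inv_smul_mem₀ hc.ne'] at h hxP
  rw [smul_add] at h
  exact (hP.2.2 _ ⟨hC.smul_mem hi hx.1, hxP⟩ _ (hC.smul_mem hi hy)).2 h

theorem smul_mem_affineSRSet {d n : ℕ} {C P : Set (Fin d → ℝ)}
    {τ : Fin n → Fin n → Option (Fin n)} (hC : IsRationalPolyhedralCone C) {c : ℝ} (hc : 0 < c)
    {x : Fin n → Fin d → ℝ} (hx : x ∈ AffineSRSet d n C P τ) :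
    c • x ∈ AffineSRSet d n C (c • P) τ := by
  obtain ⟨hlex, hxC, hxP, hsum, hinf⟩ := hx
  refine ⟨fun i j hij => lexLt_smul hc (hlex i j hij),
    fun i => ⟨hC.smul_mem hc.le (hxC i).1, smul_ne_zero hc.ne' (hxC i).2⟩,
    fun i => Set.smul_mem_smul_set (hxP i), fun i j k h => ?_, fun i j h => ?_⟩
  · simp [← hsum i j k h]
  · rw [Pi.smul_apply, Pi.smul_apply, ← smul_add, Set.smul_mem_smul_set_iff₀ hc.ne']
    exact hinf i j h

theorem smul_affineSRSet {d n : ℕ} {C P : Set (Fin d → ℝ)}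
    {τ : Fin n → Fin n → Option (Fin n)} (hC : IsRationalPolyhedralCone C) {c : ℝ} (hc : 0 < c) :
    c • AffineSRSet d n C P τ = AffineSRSet d n C (c • P) τ := by
  refine Set.Subset.antisymm ?_ fun x hx => ?_
  · rintro _ ⟨x, hx, rfl⟩
    exact smul_mem_affineSRSet hC hc hx
  · rw [Set.mem_smul_set_iff_inv_smul_mem₀ hc.ne']
    simpa [inv_smul_smul₀ hc.ne'] using smul_mem_affineSRSet hC (inv_pos.2 hc) hx

/-- The nonzero elements of `{0} ∪ range x ∪ (C \ Q)` lying in `Q` are exactly the `x i`. -/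
theorem sep_eq_range {d n : ℕ} {C Q : Set (Fin d → ℝ)} {τ : Fin n → Fin n → Option (Fin n)}
    {x : Fin n → Fin d → ℤ} (hx : (fun i => intVec (x i)) ∈ AffineSRSet d n C Q τ) :
    {s ∈ ({0} ∪ Set.range x ∪ {y : Fin d → ℤ | intVec y ∈ C \ Q} : Set (Fin d → ℤ)) |
      intVec s ∈ Q ∧ s ≠ 0} = Set.range x := by
  ext s
  constructor
  · rintro ⟨(hs | hs) | hs, hsQ, hs0⟩
    · exact absurd hs hs0
    · exact hs
    · exact absurd hsQ hs.2
  · rintro ⟨i, rfl⟩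
    exact ⟨Or.inl (Or.inr ⟨i, rfl⟩), hx.2.2.1 i, fun h => (hx.2.1 i).2 (intVec_eq_zero.2 h)⟩

theorem eq_of_range_eq {d n : ℕ} {x y : Fin n → Fin d → ℤ}
    (hx : ∀ i j, i < j → lexLt (intVec (x i)) (intVec (x j)))
    (hy : ∀ i j, i < j → lexLt (intVec (y i)) (intVec (y j)))
    (h : Set.range x = Set.range y) : x = y := by
  have hx' : StrictMono fun i => toLex (x i) := fun i j hij => lexLt_intVec.1 (hx i j hij)
  have hy' : StrictMono fun i => toLex (y i) := fun i j hij => lexLt_intVec.1 (hy i j hij)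
  have h' : (Set.range fun i => toLex (x i)) = Set.range fun i => toLex (y i) := by
    change Set.range (toLex ∘ x) = Set.range (toLex ∘ y)
    rw [Set.range_comp, Set.range_comp, h]
  exact (StrictMono.range_inj hx' hy').1 h'

theorem isCSemigroup_of_mem_affineSRSet {d n : ℕ} {C Q : Set (Fin d → ℝ)}
    {τ : Fin n → Fin n → Option (Fin n)} {x : Fin n → Fin d → ℤ}
    (hC : IsRationalPolyhedralCone C) (hQ : Bornology.IsBounded Q)
    (hadd : ∀ u ∈ C \ Q, ∀ v ∈ C, u + v ∈ C \ Q)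
    (hx : (fun i => intVec (x i)) ∈ AffineSRSet d n C Q τ) :
    IsCSemigroup C
      ({0} ∪ Set.range x ∪ {y : Fin d → ℤ | intVec y ∈ C \ Q} : Set (Fin d → ℤ)) := by
  set S : Set (Fin d → ℤ) := {0} ∪ Set.range x ∪ {y : Fin d → ℤ | intVec y ∈ C \ Q}
  obtain ⟨-, hxC, -, hsum, hinf⟩ := hx
  have hSC : ∀ s ∈ S, intVec s ∈ C := by
    rintro s ((rfl | ⟨i, rfl⟩) | hs)
    · rw [intVec_eq_zero.2 rfl]
      exact hC.zero_mem
    · exact (hxC i).1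
    · exact hs.1
  have hleft : ∀ s t, intVec s ∈ C \ Q → t ∈ S → s + t ∈ S := fun s t hs ht => by
    refine Or.inr ?_
    rw [Set.mem_ofPred_eq, intVec_add]
    exact hadd _ hs _ (hSC t ht)
  refine ⟨Or.inl (Or.inl rfl), ?_, hSC, (finite_intVec_mem hQ).subset fun y hy => ?_⟩
  · rintro s hs t ht
    rcases id hs with (rfl | ⟨i, rfl⟩) | hs'
    · rwa [zero_add]
    · rcases id ht with (rfl | ⟨j, rfl⟩) | ht'
      · rwa [add_zero]
      · rcases h : τ i j with _ | k
        · refine Or.inr ?_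
          rw [Set.mem_ofPred_eq, intVec_add]
          exact ⟨hC.add_mem (hxC i).1 (hxC j).1, hinf i j h⟩
        · refine Or.inl (Or.inr ⟨k, intVec_injective ?_⟩)
          rw [intVec_add]
          exact (hsum i j k h).symm
      · rw [add_comm]
        exact hleft _ _ ht' hs
    · exact hleft _ _ hs' ht
  · by_contra h
    exact hy.2 (Or.inr ⟨hy.1, h⟩)

/-- The lattice points of `α • P_τ^{(C,P)}` are in bijection with the `C`-semigroups
having exactly `n` nonzero elements in `αP`, all gaps in `αP`, and associated addition
table `τ` in `αP`. -/
theorem affine_sr_set_lattice_points_biject_C_semigroups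
    (d n α : ℕ) (hd : 0 < d) (hn : 0 < n) (hα : 0 < α)
    (C P : Set (Fin d → ℝ)) (hC : IsRationalPolyhedralCone C) (hCpt : IsPointed C)
    (hP : IsCCompatible C P) (τ : Fin n → Fin n → Option (Fin n)) :
    Set.BijOn
      (fun x : Fin n → Fin d → ℤ =>
        ({0} ∪ Set.range x ∪ {y : Fin d → ℤ | intVec y ∈ C \ (α : ℝ) • P} :
          Set (Fin d → ℤ)))
      {x : Fin n → Fin d → ℤ |
        (fun i => intVec (x i)) ∈ (α : ℝ) • AffineSRSet d n C P τ}
      {S : Set (Fin d → ℤ) | IsCSemigroup C S ∧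
        (∀ y : Fin d → ℤ, intVec y ∈ C → y ∉ S → intVec y ∈ (α : ℝ) • P) ∧
        ∃ x : Fin n → Fin d → ℤ,
          (∀ i j : Fin n, i < j → lexLt (intVec (x i)) (intVec (x j))) ∧
          {s ∈ S | intVec s ∈ (α : ℝ) • P ∧ s ≠ 0} = Set.range x ∧
          (∀ i j k, τ i j = some k → x i + x j = x k) ∧
          (∀ i j, τ i j = none →
            intVec (x i) + intVec (x j) ∈ C \ (α : ℝ) • P)} := by
  have hα' : (0 : ℝ) < α := by exact_mod_cast hα
  rw [smul_affineSRSet hC hα']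
  refine ⟨fun x hx => ?_, fun x hx y hy hxy => ?_, ?_⟩
  · refine ⟨isCSemigroup_of_mem_affineSRSet hC (hP.1.isBounded.smul₀ (α : ℝ))
        (fun u hu v hv => add_mem_diff_smul hC hP hα' hu hv) hx, fun y hyC hyS => ?_,
      x, hx.1, sep_eq_range hx, fun i j k h => intVec_injective ?_, fun i j h => ?_⟩
    · by_contra h
      exact hyS (Or.inr ⟨hyC, h⟩)
    · rw [intVec_add]
      exact hx.2.2.2.1 i j k h
    · exact ⟨hC.add_mem (hx.2.1 i).1 (hx.2.1 j).1, hx.2.2.2.2 i j h⟩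
  · refine eq_of_range_eq hx.1 hy.1 ?_
    rw [← sep_eq_range hx, ← sep_eq_range hy]
    exact congrArg (fun S : Set (Fin d → ℤ) => {s ∈ S | intVec s ∈ (α : ℝ) • P ∧ s ≠ 0}) hxy
  · rintro S ⟨⟨h0, -, hSC, -⟩, hgap, x, hlex, hrange, hsum, hinf⟩
    have hx : ∀ i, x i ∈ S ∧ intVec (x i) ∈ (α : ℝ) • P ∧ x i ≠ 0 := fun i =>
      hrange.symm.subset ⟨i, rfl⟩
    refine ⟨x, ⟨hlex, fun i => ⟨hSC _ (hx i).1, fun h => (hx i).2.2 (intVec_eq_zero.1 h)⟩,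
      fun i => (hx i).2.1, fun i j k h => ?_, fun i j h => (hinf i j h).2⟩, ?_⟩
    · change intVec (x i) + intVec (x j) = intVec (x k)
      rw [← intVec_add, hsum i j k h]
    · refine Set.Subset.antisymm ?_ fun s hs => ?_
      · rintro s ((rfl | ⟨i, rfl⟩) | hs)
        · exact h0
        · exact (hx i).1
        · by_contra h
          exact hs.2 (hgap s hs.1 h)
      · by_cases hs0 : s = 0
        · exact Or.inl (Or.inl hs0)
        by_cases hsP : intVec s ∈ (α : ℝ) • P
        · exact Or.inl (Or.inr (hrange.subset ⟨hs, hsP, hs0⟩))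
        · exact Or.inr ⟨hSC s hs, hsP⟩
end
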